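/- Let B be a connected N-graded algebra over a field k, generated in degree 1, with finite global dimension d, and let z be an element of B of degree 1 which is regular (a non-zerodivisor) and normal (zB = Bz). Then the quotient algebra B/(z) has global dimension d-1. -/

import Mathlib

noncomputable section

open CategoryTheory

/-- An element `y` of a ring is *normal* if `yA = Ay`. -/
def IsNormalElem {A : Type*} [Mul A] (y : A) : Prop :=
  (∀ a : A, ∃ b : A, y * a = b * y) ∧ (∀ a : A, ∃ b : A, a * y = y * b)

/-- A ring `B` has (left) global dimension at most `n` if `Ext^i(M,N)` vanishes for all
modules `M, N` and all `i > n`. -/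
def GlobalDimLE (B : Type) [Ring B] (n : ℕ) : Prop :=
  ∀ (M N : ModuleCat.{0} B) (i : ℕ), n < i →
    Subsingleton (((Ext ℤ (ModuleCat.{0} B) i).obj (Opposite.op M)).obj N)

/-- A ring `B` has global dimension exactly `d` if `d` is the least `n` with
`GlobalDimLE B n`. -/
def HasGlobalDim (B : Type) [Ring B] (d : ℕ) : Prop :=
  IsLeast {n : ℕ | GlobalDimLE B n} d

open Limits TensorProduct

theorem subsingleton_ext_iff_exists_lift {R : Type} [Ring R] {M N : ModuleCat.{0} R}
    (P : ProjectiveResolution M) (i : ℕ) :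
    Subsingleton (((Ext ℤ (ModuleCat.{0} R) (i + 1)).obj (Opposite.op M)).obj N) ↔
      ∀ f : P.complex.X (i + 1) ⟶ N, P.complex.d (i + 2) (i + 1) ≫ f = 0 →
        ∃ g : P.complex.X i ⟶ N, P.complex.d (i + 1) i ≫ g = f := by
  rw [← ModuleCat.isZero_iff_subsingleton, (P.isoExt (R := ℤ) (i + 1) N).isZero_iff,
    ← HomologicalComplex.exactAt_iff_isZero_homology,
    HomologicalComplex.exactAt_iff' _ i (i + 1) (i + 2) (by simp) (by simp),
    ShortComplex.moduleCat_exact_iff]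
  rfl

theorem subsingleton_abelianExt_iff_exists_lift {R : Type} [Ring R] {M N : ModuleCat.{0} R}
    (P : ProjectiveResolution M) (i : ℕ) :
    Subsingleton (Abelian.Ext M N (i + 1)) ↔
      ∀ f : P.complex.X (i + 1) ⟶ N, P.complex.d (i + 2) (i + 1) ≫ f = 0 →
        ∃ g : P.complex.X i ⟶ N, P.complex.d (i + 1) i ≫ g = f := by
  rw [subsingleton_iff_forall_eq 0]
  constructor
  · intro h f hf
    exact (P.extMk_eq_zero_iff f (i + 2) rfl hf i rfl).1 (h _)
  · intro h e
    obtain ⟨f, hf, rfl⟩ := P.extMk_surjective e (i + 2) rfl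
    exact (P.extMk_eq_zero_iff f (i + 2) rfl hf i rfl).2 (h f hf)

theorem globalDimLE_iff_hasProjectiveDimensionLT (R : Type) [Ring R] (n : ℕ) :
    GlobalDimLE R n ↔ ∀ M : ModuleCat.{0} R, HasProjectiveDimensionLT M (n + 1) := by
  have key (M N : ModuleCat.{0} R) (i : ℕ) :
      Subsingleton (((Ext ℤ (ModuleCat.{0} R) (i + 1)).obj (Opposite.op M)).obj N) ↔
        Subsingleton (Abelian.Ext M N (i + 1)) :=
    (subsingleton_ext_iff_exists_lift (projectiveResolution M) i).trans
      (subsingleton_abelianExt_iff_exists_lift (projectiveResolution M) i).symm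
  constructor
  · intro h M
    refine HasProjectiveDimensionLT.mk fun i hi N e => ?_
    obtain ⟨i, rfl⟩ : ∃ j, i = j + 1 := ⟨i - 1, by lia⟩
    have := (key M N i).1 (h M N (i + 1) hi)
    exact Subsingleton.elim _ _
  · intro h M N i hi
    obtain ⟨i, rfl⟩ : ∃ j, i = j + 1 := ⟨i - 1, by lia⟩
    have := h M
    exact (key M N i).2 (HasProjectiveDimensionLT.subsingleton M (n + 1) (i + 1) hi N)

/-- The module `M` has projective dimension at most `n`. -/
def ProjDimLE (R : Type) [Ring R] (M : Type) [AddCommGroup M] [Module R M] (n : ℕ) : Prop :=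
  HasProjectiveDimensionLT (ModuleCat.of R M) (n + 1)

namespace ProjDimLE

variable {R : Type} [Ring R] {M N P : Type} [AddCommGroup M] [Module R M] [AddCommGroup N]
  [Module R N] [AddCommGroup P] [Module R P]

theorem _root_.globalDimLE_iff_projDimLE (R : Type) [Ring R] (n : ℕ) :
    GlobalDimLE R n ↔ ∀ (M : Type) [AddCommGroup M] [Module R M], ProjDimLE R M n :=
  (globalDimLE_iff_hasProjectiveDimensionLT R n).trans
    ⟨fun h M _ _ => h (.of R M), fun h M => h M⟩

theorem zero_iff : ProjDimLE R M 0 ↔ Module.Projective R M :=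
  projective_iff_hasProjectiveDimensionLT_one.symm.trans
    (IsProjective.iff_projective M).symm

theorem mono {m n : ℕ} (h : ProjDimLE R M m) (hmn : m ≤ n) : ProjDimLE R M n :=
  have : HasProjectiveDimensionLT (ModuleCat.of R M) (m + 1) := h
  hasProjectiveDimensionLT_of_ge _ (m + 1) (n + 1) (by lia)

theorem of_projective [h : Module.Projective R M] (n : ℕ) : ProjDimLE R M n :=
  mono (zero_iff.2 h) n.zero_le

theorem of_retract {n : ℕ} (h : ProjDimLE R M n) (i : N →ₗ[R] M) (r : M →ₗ[R] N)
    (hri : r ∘ₗ i = LinearMap.id) : ProjDimLE R N n :=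
  have : HasProjectiveDimensionLT (ModuleCat.of R M) (n + 1) := h
  Retract.hasProjectiveDimensionLT
    (⟨ModuleCat.ofHom i, ModuleCat.ofHom r, by rw [← ModuleCat.ofHom_comp, hri]; rfl⟩ :
      Retract (ModuleCat.of R N) (ModuleCat.of R M)) (n + 1)

theorem of_equiv {n : ℕ} (h : ProjDimLE R M n) (e : M ≃ₗ[R] N) : ProjDimLE R N n :=
  h.of_retract e.symm.toLinearMap e.toLinearMap (by ext; simp)

theorem _root_.ModuleCat.shortExact_of_linearMap (i : N →ₗ[R] P) (f : P →ₗ[R] M)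
    (hi : Function.Injective i) (hf : Function.Surjective f) (h : Function.Exact i f) :
    (ShortComplex.mk (ModuleCat.ofHom i) (ModuleCat.ofHom f)
      (by rw [← ModuleCat.ofHom_comp, h.linearMap_comp_eq_zero]; rfl)).ShortExact :=
  { exact := (ShortComplex.ShortExact.moduleCat_exact_iff_function_exact _).2 h
    mono_f := (ModuleCat.mono_iff_injective _).2 hi
    epi_g := (ModuleCat.epi_iff_surjective _).2 hf }

theorem succ_iff [Module.Projective R P] {n : ℕ} (i : N →ₗ[R] P) (f : P →ₗ[R] M)
    (hi : Function.Injective i) (hf : Function.Surjective f) (h : Function.Exact i f) :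
    ProjDimLE R M (n + 1) ↔ ProjDimLE R N n :=
  (ModuleCat.shortExact_of_linearMap i f hi hf h).hasProjectiveDimensionLT_X₃_iff n
    inferInstance

theorem of_exact {n : ℕ} (i : N →ₗ[R] P) (f : P →ₗ[R] M)
    (hi : Function.Injective i) (hf : Function.Surjective f) (h : Function.Exact i f)
    (hN : ProjDimLE R N n) (hP : ProjDimLE R P (n + 1)) : ProjDimLE R M (n + 1) :=
  (ModuleCat.shortExact_of_linearMap i f hi hf h).hasProjectiveDimensionLT_X₃ (n + 1) hN hP

end ProjDimLE

section Grading

open Finset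

variable {k : Type} [Field k] {V W : Type} [AddCommGroup V] [Module k V] [AddCommGroup W]
  [Module k W]

/-- A family of linear endomorphisms is the family of projections of an `ℕ`-grading. -/
structure IsGrading (π : ℕ → V →ₗ[k] V) : Prop where
  proj_proj : ∀ p q v, π p (π q v) = if p = q then π q v else 0
  sum_proj : ∀ v, ∃ N, ∀ M ≥ N, ∑ p ∈ range M, π p v = v

/-- The elements all of whose components have degree less than `p`. -/
def degreeLT (π : ℕ → V →ₗ[k] V) (p : ℕ) : Submodule k V :=
  ⨅ q ≥ p, LinearMap.ker (π q)

theorem mem_degreeLT {π : ℕ → V →ₗ[k] V} {p : ℕ} {v : V} :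
    v ∈ degreeLT π p ↔ ∀ q ≥ p, π q v = 0 := by
  simp [degreeLT]

theorem degreeLT_mono {π : ℕ → V →ₗ[k] V} {p q : ℕ} (h : p ≤ q) :
    degreeLT π p ≤ degreeLT π q := fun _ hv =>
  mem_degreeLT.2 fun r hr => mem_degreeLT.1 hv r (h.trans hr)

namespace IsGrading

variable {π : ℕ → V →ₗ[k] V} {σ : ℕ → W →ₗ[k] W}

theorem proj_of_homogeneous (hπ : IsGrading π) {p : ℕ} {v : V} (hv : π p v = v) (q : ℕ) :
    π q v = if q = p then v else 0 := by
  have := hπ.proj_proj q p v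
  rwa [hv] at this

theorem exists_mem_degreeLT (hπ : IsGrading π) (v : V) : ∃ p, v ∈ degreeLT π p := by
  obtain ⟨N, hN⟩ := hπ.sum_proj v
  refine ⟨N, mem_degreeLT.2 fun q hq => ?_⟩
  rw [← hN N le_rfl, map_sum]
  refine sum_eq_zero fun p hp => ?_
  rw [hπ.proj_proj, if_neg]
  have := mem_range.1 hp
  lia

theorem mem_degreeLT_of_homogeneous (hπ : IsGrading π) {p q : ℕ} {v : V} (hv : π p v = v)
    (hpq : p < q) : v ∈ degreeLT π q :=
  mem_degreeLT.2 fun r hr => by rw [hπ.proj_of_homogeneous hv, if_neg (by lia)]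

theorem eq_zero_of_mem_degreeLT_zero (hπ : IsGrading π) {v : V} (hv : v ∈ degreeLT π 0) :
    v = 0 := by
  obtain ⟨N, hN⟩ := hπ.sum_proj v
  rw [← hN N le_rfl]
  exact sum_eq_zero fun p _ => mem_degreeLT.1 hv p p.zero_le

theorem map_mem_degreeLT (hπ : IsGrading π) (f : V →ₗ[k] W)
    (hf : ∀ p v, π p v = v → f v ∈ degreeLT σ p) {p : ℕ} {v : V} (hv : v ∈ degreeLT π (p + 1)) :
    f v ∈ degreeLT σ p := by
  obtain ⟨N, hN⟩ := hπ.sum_proj v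
  rw [← hN N le_rfl, map_sum]
  refine Submodule.sum_mem _ fun q _ => ?_
  by_cases hq : q ≤ p
  · exact degreeLT_mono hq (hf q _ (by simp [hπ.proj_proj]))
  · rw [mem_degreeLT.1 hv q (by lia), map_zero]
    exact zero_mem _

/-- A linear endomorphism congruent to the identity modulo lower degrees is bijective. -/
theorem bijective_of_sub_mem_degreeLT (hπ : IsGrading π) (f : V →ₗ[k] V)
    (hf : ∀ p v, π p v = v → f v - v ∈ degreeLT π p) : Function.Bijective f := by
  have hlow (p : ℕ) (v : V) (hv : v ∈ degreeLT π (p + 1)) : f v - v ∈ degreeLT π p :=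
    hπ.map_mem_degreeLT (f - LinearMap.id) hf hv
  constructor
  · rw [injective_iff_map_eq_zero]
    have H (p : ℕ) : ∀ v ∈ degreeLT π p, f v = 0 → v = 0 := by
      induction p with
      | zero => exact fun v hv _ => hπ.eq_zero_of_mem_degreeLT_zero hv
      | succ p ih =>
        intro v hv h
        refine ih v ?_ h
        simpa [h] using hlow p v hv
    intro v hv
    obtain ⟨p, hp⟩ := hπ.exists_mem_degreeLT v
    exact H p v hp hv
  · have H (p : ℕ) : ∀ v ∈ degreeLT π p, ∃ w, f w = v := by
      induction p with
      | zero => exact fun v hv => ⟨0, by simp [hπ.eq_zero_of_mem_degreeLT_zero hv]⟩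
      | succ p ih =>
        intro v hv
        obtain ⟨w, hw⟩ := ih _ (hlow p v hv)
        exact ⟨v - w, by rw [map_sub, hw]; abel⟩
    intro v
    obtain ⟨p, hp⟩ := hπ.exists_mem_degreeLT v
    exact H p v hp

@[elab_as_elim]
theorem induction_on (hπ : IsGrading π) {P : V → Prop} (v : V) (zero : P 0)
    (add : ∀ v w, P v → P w → P (v + w)) (homogeneous : ∀ p v, π p v = v → P v) : P v := by
  obtain ⟨N, hN⟩ := hπ.sum_proj v
  rw [← hN N le_rfl]
  exact sum_induction _ P add zero fun p _ => homogeneous p _ (by simp [hπ.proj_proj])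

theorem finite_support (hπ : IsGrading π) (φ : ℕ → V →ₗ[k] W) (v : V) :
    (Function.support fun p => φ p (π p v)).Finite := by
  obtain ⟨N, hN⟩ := hπ.exists_mem_degreeLT v
  refine (range N).finite_toSet.subset fun p hp => ?_
  by_contra h
  exact hp (by simp [mem_degreeLT.1 hN p (by simpa using h)])

theorem exists_linearMap (hπ : IsGrading π) (φ : ℕ → V →ₗ[k] W) :
    ∃ f : V →ₗ[k] W, ∀ p v, π p v = v → f v = φ p v := by
  refine ⟨{ toFun := fun v => ∑ᶠ p, φ p (π p v)
            map_add' := fun v w => ?_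
            map_smul' := fun c v => ?_ }, fun p v hv => ?_⟩
  · simp only [map_add]
    exact finsum_add_distrib (hπ.finite_support φ v) (hπ.finite_support φ w)
  · simp only [map_smul, RingHom.id_apply]
    exact (smul_finsum' c (hπ.finite_support φ v)).symm
  · change ∑ᶠ q, φ q (π q v) = φ p v
    rw [finsum_eq_single _ p fun q hq => by simp [hπ.proj_of_homogeneous hv, hq], hv]

end IsGrading

/-- The projections of the total grading on a tensor product. -/
def tensorProj (π : ℕ → V →ₗ[k] V) (σ : ℕ → W →ₗ[k] W) (p : ℕ) : V ⊗[k] W →ₗ[k] V ⊗[k] W :=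
  ∑ x ∈ antidiagonal p, TensorProduct.map (π x.1) (σ x.2)

namespace IsGrading

variable {π : ℕ → V →ₗ[k] V} {σ : ℕ → W →ₗ[k] W}

@[elab_as_elim]
theorem tensor_induction_on (hπ : IsGrading π) (hσ : IsGrading σ) {P : V ⊗[k] W → Prop}
    (t : V ⊗[k] W) (zero : P 0) (add : ∀ s t, P s → P t → P (s + t))
    (homogeneous : ∀ i v j w, π i v = v → σ j w = w → P (v ⊗ₜ w)) : P t := by
  induction t with
  | zero => exact zero
  | add s t hs ht => exact add s t hs ht
  | tmul v w =>
    refine hπ.induction_on (P := fun v => P (v ⊗ₜ w)) v (by simpa using zero)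
      (fun _ _ h h' => by rw [add_tmul]; exact add _ _ h h') fun i v hv => ?_
    exact hσ.induction_on (P := fun w => P (v ⊗ₜ w)) w (by simpa using zero)
      (fun _ _ h h' => by rw [tmul_add]; exact add _ _ h h') fun j w hw =>
        homogeneous i v j w hv hw

theorem tensorProj_tmul (hπ : IsGrading π) (hσ : IsGrading σ) {i j : ℕ} {v : V} {w : W}
    (hv : π i v = v) (hw : σ j w = w) (p : ℕ) :
    tensorProj π σ p (v ⊗ₜ w) = if p = i + j then v ⊗ₜ w else 0 := by
  have (x : ℕ × ℕ) : TensorProduct.map (π x.1) (σ x.2) (v ⊗ₜ[k] w) =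
      if x = (i, j) then v ⊗ₜ w else 0 := by
    rw [map_tmul, hπ.proj_of_homogeneous hv, hσ.proj_of_homogeneous hw]
    obtain ⟨a, b⟩ := x
    by_cases ha : a = i <;> by_cases hb : b = j <;> simp [ha, hb]
  simp only [tensorProj, LinearMap.sum_apply, this]
  rw [sum_ite_eq' (antidiagonal p) (i, j)]
  simp [eq_comm]

theorem tensor (hπ : IsGrading π) (hσ : IsGrading σ) : IsGrading (tensorProj π σ) where
  proj_proj p q t := by
    refine hπ.tensor_induction_on hσ t (by simp) (fun s t hs ht => ?_) fun i v j w hv hw => ?_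
    · simp only [map_add, hs, ht]
      split_ifs <;> simp
    · rw [hπ.tensorProj_tmul hσ hv hw]
      split_ifs with h h' h' <;> simp [hπ.tensorProj_tmul hσ hv hw] <;> lia
  sum_proj t := by
    refine hπ.tensor_induction_on hσ t ⟨0, by simp⟩ ?_ fun i v j w hv hw => ?_
    · rintro s t ⟨N, hN⟩ ⟨N', hN'⟩
      refine ⟨max N N', fun M hM => ?_⟩
      simp only [map_add, sum_add_distrib]
      rw [hN M (by lia), hN' M (by lia)]
    · refine ⟨i + j + 1, fun M hM => ?_⟩
      simp only [hπ.tensorProj_tmul hσ hv hw]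
      rw [sum_ite_eq' (range M) (i + j), if_pos (by simp; lia)]

theorem tmul_mem_degreeLT (hπ : IsGrading π) (hσ : IsGrading σ) {i j : ℕ} {v : V} {w : W}
    (hv : π i v = v) (hw : w ∈ degreeLT σ j) : v ⊗ₜ w ∈ degreeLT (tensorProj π σ) (i + j) := by
  cases j with
  | zero => simp [hσ.eq_zero_of_mem_degreeLT_zero hw]
  | succ j =>
    refine degreeLT_mono (p := i + j + 1) (by lia) ?_
    obtain ⟨N, hN⟩ := hσ.sum_proj w
    rw [← hN N le_rfl, tmul_sum]
    refine Submodule.sum_mem _ fun q _ => ?_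
    by_cases hq : q ≤ j
    · have hwq : σ q (σ q w) = σ q w := by simp [hσ.proj_proj]
      exact (hπ.tensor hσ).mem_degreeLT_of_homogeneous (p := i + q)
        (by rw [hπ.tensorProj_tmul hσ hv hwq, if_pos rfl]) (by lia)
    · rw [mem_degreeLT.1 hw q (by lia), tmul_zero]
      exact zero_mem _

end IsGrading

end Grading

section ConnectedGrading

variable {k : Type} [Field k] {C : Type} [Ring C] [Algebra k C]

/-- A family of projections makes `C` a connected graded algebra with augmentation `ε`. -/
structure IsConnectedGrading (π : ℕ → C →ₗ[k] C) (ε : C →ₐ[k] k) : Prop extends IsGrading π where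
  mul : ∀ i a j b, π i a = a → π j b = b → π (i + j) (a * b) = a * b
  proj_zero : ∀ a, π 0 a = algebraMap k C (ε a)

/-- The augmentation ideal, as a subspace. -/
abbrev augmentationIdeal (ε : C →ₐ[k] k) : Submodule k C := LinearMap.ker ε.toLinearMap

/-- The projection onto the augmentation ideal. -/
def augmentationProj (ε : C →ₐ[k] k) : C →ₗ[k] augmentationIdeal ε :=
  (LinearMap.id - (Algebra.linearMap k C) ∘ₗ ε.toLinearMap).codRestrict _ (by simp)

@[simp]
theorem coe_augmentationProj (ε : C →ₐ[k] k) (a : C) :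
    (augmentationProj ε a : C) = a - algebraMap k C (ε a) := rfl

@[simp]
theorem augmentationProj_coe (ε : C →ₐ[k] k) (a : augmentationIdeal ε) :
    augmentationProj ε (a : C) = a := by
  have : ε a = 0 := a.2
  ext; simp [this]

@[simp]
theorem augmentationProj_one (ε : C →ₐ[k] k) : augmentationProj ε 1 = 0 := by
  ext; simp

/-- Left multiplication on the augmentation ideal. -/
def augmentationMul (ε : C →ₐ[k] k) (c : C) : augmentationIdeal ε →ₗ[k] augmentationIdeal ε :=
  augmentationProj ε ∘ₗ LinearMap.mulLeft k c ∘ₗ (augmentationIdeal ε).subtype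

@[simp]
theorem coe_augmentationMul (ε : C →ₐ[k] k) (c : C) (a : augmentationIdeal ε) :
    (augmentationMul ε c a : C) = c * a := by
  have : ε a = 0 := a.2
  simp [augmentationMul, this]

namespace IsConnectedGrading

variable {π : ℕ → C →ₗ[k] C} {ε : C →ₐ[k] k} (h : IsConnectedGrading π ε)
include h

theorem augmentation_eq_zero {i : ℕ} {a : C} (ha : π i a = a) (hi : i ≠ 0) : ε a = 0 := by
  have h₁ := h.proj_zero a
  rw [h.proj_of_homogeneous ha, if_neg hi.symm] at h₁
  simpa using (congrArg ε h₁).symm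

theorem eq_algebraMap {a : C} (ha : π 0 a = a) : a = algebraMap k C (ε a) :=
  ha.symm.trans (h.proj_zero a)

theorem proj_mem_augmentationIdeal (p : ℕ) (a : C) (ha : a ∈ augmentationIdeal ε) :
    π p a ∈ augmentationIdeal ε := by
  by_cases hp : p = 0
  · subst hp
    have : ε a = 0 := ha
    simp [h.proj_zero, this]
  · exact h.augmentation_eq_zero (by simp [h.proj_proj]) hp

end IsConnectedGrading

/-- The projections of the grading on the augmentation ideal. -/
def augmentationGrading {π : ℕ → C →ₗ[k] C} {ε : C →ₐ[k] k} (h : IsConnectedGrading π ε) (p : ℕ) :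
    augmentationIdeal ε →ₗ[k] augmentationIdeal ε :=
  (π p).restrict (h.proj_mem_augmentationIdeal p)

theorem isGrading_augmentationGrading {π : ℕ → C →ₗ[k] C} {ε : C →ₐ[k] k}
    (h : IsConnectedGrading π ε) : IsGrading (augmentationGrading h) where
  proj_proj p q a := by
    ext
    have := h.proj_proj p q a
    split_ifs at this ⊢ <;> simpa [augmentationGrading]
  sum_proj a := by
    obtain ⟨N, hN⟩ := h.sum_proj a
    refine ⟨N, fun M hM => ?_⟩
    ext
    simpa [augmentationGrading] using hN M hM

theorem augmentationGrading_eq_iff {π : ℕ → C →ₗ[k] C} {ε : C →ₐ[k] k}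
    (h : IsConnectedGrading π ε) {p : ℕ} {a : augmentationIdeal ε} :
    augmentationGrading h p a = a ↔ π p (a : C) = a := by
  rw [Subtype.ext_iff]; rfl

end ConnectedGrading

section ActionModule

variable {k : Type} [Field k] {C : Type} [Ring C] [Algebra k C]
  {S : Type} [AddCommGroup S] [Module k S]

/-- The `C`-module defined by an algebra homomorphism `C → End S`. -/
def ActionModule (_ : C →ₐ[k] Module.End k S) : Type := S

namespace ActionModule

variable (ρ : C →ₐ[k] Module.End k S)

instance : AddCommGroup (ActionModule ρ) := inferInstanceAs (AddCommGroup S)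

instance : Module C (ActionModule ρ) where
  smul c s := ρ c s
  one_smul s := congrArg (fun f : Module.End k S => f s) (map_one ρ)
  mul_smul a b s := congrArg (fun f : Module.End k S => f s) (map_mul ρ a b)
  smul_zero a := map_zero (ρ a)
  smul_add a s t := map_add (ρ a) s t
  add_smul a b s := congrArg (fun f : Module.End k S => f s) (map_add ρ a b)
  zero_smul s := congrArg (fun f : Module.End k S => f s) (map_zero ρ)

/-- The underlying space of `ActionModule ρ` is `S`. -/
def equiv : ActionModule ρ ≃+ S := AddEquiv.refl S

@[simp]
theorem equiv_smul (c : C) (s : ActionModule ρ) : equiv ρ (c • s) = ρ c (equiv ρ s) := rfl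

/-- The action map `C ⊗ S → S`. -/
def act : C ⊗[k] S →ₗ[k] S := TensorProduct.lift ρ.toLinearMap

@[simp]
theorem act_tmul (c : C) (s : S) : act ρ (c ⊗ₜ s) = ρ c s := rfl

theorem act_smul (c : C) (t : C ⊗[k] S) : act ρ (c • t) = ρ c (act ρ t) := by
  induction t with
  | zero => simp
  | add s t hs ht => simp [hs, ht]
  | tmul d s => simp [smul_tmul']

/-- The action map `C ⊗ S → S`, as a homomorphism of `C`-modules. -/
def actHom : C ⊗[k] S →ₗ[C] ActionModule ρ where
  toFun t := (equiv ρ).symm (act ρ t)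
  map_add' s t := by simp
  map_smul' c t := (equiv ρ).injective (by simp [act_smul])

theorem actHom_surjective : Function.Surjective (actHom ρ) := fun s =>
  ⟨1 ⊗ₜ equiv ρ s, (equiv ρ).injective (by simp [actHom])⟩

variable (ε : C →ₐ[k] k)

/-- The embedding of the syzygy into `C ⊗ S`. -/
def syzygyEmb : augmentationIdeal ε ⊗[k] S →ₗ[k] C ⊗[k] S :=
  TensorProduct.map (augmentationIdeal ε).subtype LinearMap.id -
    TensorProduct.mk k C S 1 ∘ₗ
      act ρ ∘ₗ TensorProduct.map (augmentationIdeal ε).subtype LinearMap.id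

@[simp]
theorem syzygyEmb_tmul (b : augmentationIdeal ε) (s : S) :
    syzygyEmb ρ ε (b ⊗ₜ s) = (b : C) ⊗ₜ s - 1 ⊗ₜ ρ (b : C) s := rfl

theorem map_augmentationProj_syzygyEmb (t : augmentationIdeal ε ⊗[k] S) :
    TensorProduct.map (augmentationProj ε) LinearMap.id (syzygyEmb ρ ε t) = t := by
  induction t with
  | zero => simp
  | add s t hs ht => simp [hs, ht]
  | tmul b s => simp

theorem syzygyEmb_map_augmentationProj (t : C ⊗[k] S) :
    syzygyEmb ρ ε (TensorProduct.map (augmentationProj ε) LinearMap.id t) =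
      t - 1 ⊗ₜ act ρ t := by
  induction t with
  | zero => simp
  | add s t hs ht => simp [hs, ht, tmul_add]; abel
  | tmul c s => simp [sub_tmul, tmul_sub, Algebra.algebraMap_eq_smul_one, smul_tmul']

theorem act_syzygyEmb (t : augmentationIdeal ε ⊗[k] S) : act ρ (syzygyEmb ρ ε t) = 0 := by
  induction t with
  | zero => simp
  | add s t hs ht => simp [hs, ht]
  | tmul b s => simp

/-- The `C`-action on `C₊ ⊗ S` which makes it the kernel of `C ⊗ S → S`. -/
def syzygyAction : C →ₐ[k] Module.End k (augmentationIdeal ε ⊗[k] S) :=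
  AlgHom.ofLinearMap
    { toFun := fun c => TensorProduct.map (augmentationProj ε) LinearMap.id ∘ₗ
        Algebra.lsmul k k (C ⊗[k] S) c ∘ₗ syzygyEmb ρ ε
      map_add' := fun c d => LinearMap.ext fun t => by
        simp only [LinearMap.comp_apply, LinearMap.add_apply, map_add]
      map_smul' := fun r c => LinearMap.ext fun t => by
        simp only [LinearMap.comp_apply, LinearMap.smul_apply, map_smul, RingHom.id_apply] }
    (LinearMap.ext fun t => by
      simpa using map_augmentationProj_syzygyEmb ρ ε t)
    (fun c d => LinearMap.ext fun t => by
      change TensorProduct.map (augmentationProj ε) LinearMap.id ((c * d) • syzygyEmb ρ ε t) =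
        TensorProduct.map (augmentationProj ε) LinearMap.id (c • syzygyEmb ρ ε
          (TensorProduct.map (augmentationProj ε) LinearMap.id (d • syzygyEmb ρ ε t)))
      rw [syzygyEmb_map_augmentationProj, act_smul, act_syzygyEmb, map_zero, tmul_zero, sub_zero,
        mul_smul])

theorem syzygyAction_apply (c : C) (t : augmentationIdeal ε ⊗[k] S) :
    syzygyAction ρ ε c t =
      TensorProduct.map (augmentationProj ε) LinearMap.id (c • syzygyEmb ρ ε t) := rfl

theorem syzygyAction_tmul (c : C) (b : augmentationIdeal ε) (s : S) :
    syzygyAction ρ ε c (b ⊗ₜ s) =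
      augmentationMul ε c b ⊗ₜ s - augmentationProj ε c ⊗ₜ ρ (b : C) s := by
  rw [syzygyAction_apply, syzygyEmb_tmul, smul_sub, smul_tmul', smul_tmul', map_sub, map_tmul,
    map_tmul]
  simp [augmentationMul]

theorem syzygyEmb_smul (c : C) (t : augmentationIdeal ε ⊗[k] S) :
    syzygyEmb ρ ε (syzygyAction ρ ε c t) = c • syzygyEmb ρ ε t := by
  rw [syzygyAction_apply, syzygyEmb_map_augmentationProj, act_smul, act_syzygyEmb, map_zero,
    tmul_zero, sub_zero]

/-- The embedding of the syzygy into `C ⊗ S`, as a homomorphism of `C`-modules. -/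
def syzygyHom :
    ActionModule (S := augmentationIdeal ε ⊗[k] S) (syzygyAction ρ ε) →ₗ[C] C ⊗[k] S where
  toFun t := syzygyEmb ρ ε (equiv _ t)
  map_add' s t := by simp
  map_smul' c t := syzygyEmb_smul ρ ε c t

theorem projDimLE_succ_iff (n : ℕ) :
    ProjDimLE C (ActionModule ρ) (n + 1) ↔
      ProjDimLE C (ActionModule (S := augmentationIdeal ε ⊗[k] S) (syzygyAction ρ ε)) n := by
  refine ProjDimLE.succ_iff (syzygyHom ρ ε) (actHom ρ)
    (Function.LeftInverse.injective (map_augmentationProj_syzygyEmb ρ ε))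
    (actHom_surjective ρ) fun t => ⟨fun ht => ?_, ?_⟩
  · have ht : act ρ t = 0 := ht
    exact ⟨_, (syzygyEmb_map_augmentationProj ρ ε t).trans (by simp [ht])⟩
  · rintro ⟨t, rfl⟩
    exact act_syzygyEmb ρ ε t

end ActionModule

end ActionModule

section Deformation

variable {k : Type} [Field k] {C : Type} [Ring C] [Algebra k C]
  {V W S : Type} [AddCommGroup V] [Module k V] [AddCommGroup W] [Module k W]
  [AddCommGroup S] [Module k S]

@[elab_as_elim]
theorem IsGrading.tensor_induction_on_of_homogeneous {π : ℕ → V →ₗ[k] V} {σ : ℕ → W →ₗ[k] W}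
    (hπ : IsGrading π) (hσ : IsGrading σ) {P : V ⊗[k] W → Prop} {p : ℕ} {t : V ⊗[k] W}
    (ht : tensorProj π σ p t = t) (zero : P 0) (add : ∀ s t, P s → P t → P (s + t))
    (homogeneous : ∀ i v j w, π i v = v → σ j w = w → i + j = p → P (v ⊗ₜ w)) : P t := by
  rw [← ht]
  clear ht
  refine hπ.tensor_induction_on hσ t ?_ (fun s t hs ht => ?_) fun i v j w hv hw => ?_
  · rwa [map_zero]
  · rw [map_add]
    exact add _ _ hs ht
  · rw [hπ.tensorProj_tmul hσ hv hw]
    split_ifs with h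
    · exact homogeneous i v j w hv hw h.symm
    · exact zero

theorem add_sub_add_mem_degreeLT {π : ℕ → V →ₗ[k] V} {p : ℕ} {a b c d : V}
    (h : a - b ∈ degreeLT π p) (h' : c - d ∈ degreeLT π p) : a + c - (b + d) ∈ degreeLT π p := by
  rw [add_sub_add_comm]
  exact add_mem h h'

theorem sub_mem_degreeLT_comm {π : ℕ → V →ₗ[k] V} {p : ℕ} {a b : V} (h : a - b ∈ degreeLT π p) :
    b - a ∈ degreeLT π p := by
  rw [← neg_sub]
  exact neg_mem h

theorem IsConnectedGrading.tensorProj_smul {π : ℕ → C →ₗ[k] C} {ε : C →ₐ[k] k}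
    {σ : ℕ → S →ₗ[k] S} (hπ : IsConnectedGrading π ε) (hσ : IsGrading σ) {i : ℕ} {c : C}
    (hc : π i c = c) (j : ℕ) (t : C ⊗[k] S) :
    tensorProj π σ (i + j) (c • t) = c • tensorProj π σ j t := by
  refine hπ.tensor_induction_on hσ t (by simp) (fun s t hs ht => ?_) fun p a q s ha hs => ?_
  · simp only [smul_add, map_add, hs, ht]
  · rw [smul_tmul', smul_eq_mul, hπ.tensorProj_tmul hσ (hπ.mul i c p a hc ha) hs,
      hπ.tensorProj_tmul hσ ha hs, smul_ite, smul_zero, smul_tmul', smul_eq_mul]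
    exact if_congr (by lia) rfl rfl

/-- `ρ₁` is a graded action of `C` on `S`, and `ρ₂` is an action whose leading term is `ρ₁`. -/
structure IsDeformation (π : ℕ → C →ₗ[k] C) (σ : ℕ → S →ₗ[k] S)
    (ρ₁ ρ₂ : C →ₐ[k] Module.End k S) : Prop where
  graded : ∀ i a j s, π i a = a → σ j s = s → σ (i + j) (ρ₁ a s) = ρ₁ a s
  sub_mem : ∀ i a j s, π i a = a → σ j s = s → ρ₂ a s - ρ₁ a s ∈ degreeLT σ (i + j)

namespace IsDeformation

variable {π : ℕ → C →ₗ[k] C} {ε : C →ₐ[k] k} {σ : ℕ → S →ₗ[k] S}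
  {ρ₁ ρ₂ : C →ₐ[k] Module.End k S}

open ActionModule

theorem syzygyAction (h : IsDeformation π σ ρ₁ ρ₂) (hπ : IsConnectedGrading π ε)
    (hσ : IsGrading σ) :
    IsDeformation π (tensorProj (augmentationGrading hπ) σ) (syzygyAction ρ₁ ε)
      (syzygyAction ρ₂ ε) := by
  have hC := isGrading_augmentationGrading hπ
  have hpr {i : ℕ} {c : C} (hc : π i c = c) :
      augmentationGrading hπ i (augmentationProj ε c) = augmentationProj ε c := by
    by_cases hi : i = 0
    · subst hi
      rw [hπ.eq_algebraMap hc]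
      have : augmentationProj ε (algebraMap k C (ε c)) = 0 := by ext; simp
      simp [this]
    · rw [augmentationGrading_eq_iff]
      simp [hπ.augmentation_eq_zero hc hi, hc]
  constructor
  · intro i c p t hc ht
    refine hC.tensor_induction_on_of_homogeneous hσ ht (by simp)
      (fun s t hs ht => by simp only [map_add, hs, ht]) fun j b l s hb hs hp => ?_
    have hb' := (augmentationGrading_eq_iff hπ).1 hb
    have hcb : augmentationGrading hπ (i + j) (augmentationMul ε c b) = augmentationMul ε c b := by
      rw [augmentationGrading_eq_iff, coe_augmentationMul]
      exact hπ.mul i c j b hc hb'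
    rw [syzygyAction_tmul, map_sub, hC.tensorProj_tmul hσ hcb hs, if_pos (by lia),
      hC.tensorProj_tmul hσ (hpr hc) (h.graded j b l s hb' hs), if_pos (by lia)]
  · intro i c p t hc ht
    refine hC.tensor_induction_on_of_homogeneous hσ ht (by simp) (fun s t hs ht => ?_)
      fun j b l s hb hs hp => ?_
    · rw [map_add, map_add]
      exact add_sub_add_mem_degreeLT hs ht
    · have hb' := (augmentationGrading_eq_iff hπ).1 hb
      rw [syzygyAction_tmul, syzygyAction_tmul, sub_sub_sub_cancel_left, ← tmul_sub, ← hp]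
      exact hC.tmul_mem_degreeLT hσ (hpr hc) (sub_mem_degreeLT_comm (h.sub_mem j b l s hb' hs))

theorem act_tensorProj (h : IsDeformation π σ ρ₁ ρ₂) (hπ : IsConnectedGrading π ε)
    (hσ : IsGrading σ) (p : ℕ) (t : C ⊗[k] S) :
    act ρ₁ (tensorProj π σ p t) = σ p (act ρ₁ t) := by
  refine hπ.tensor_induction_on hσ t (by simp) (fun s t hs ht => ?_) fun i a j s ha hs => ?_
  · simp only [map_add, hs, ht]
  · rw [hπ.tensorProj_tmul hσ ha hs, act_tmul, hσ.proj_of_homogeneous (h.graded i a j s ha hs)]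
    split_ifs <;> simp

theorem act_sub_act_mem (h : IsDeformation π σ ρ₁ ρ₂) (hπ : IsConnectedGrading π ε)
    (hσ : IsGrading σ) {p : ℕ} {t : C ⊗[k] S} (ht : tensorProj π σ p t = t) :
    act ρ₂ t - act ρ₁ t ∈ degreeLT σ p := by
  refine hπ.tensor_induction_on_of_homogeneous hσ ht (by simp) (fun s t hs ht => ?_)
    fun i a j s ha hs hp => ?_
  · rw [map_add, map_add]
    exact add_sub_add_mem_degreeLT hs ht
  · rw [← hp]
    exact h.sub_mem i a j s ha hs

theorem exists_linearMap_section (ρ : C →ₐ[k] Module.End k S)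
    [Module.Projective C (ActionModule ρ)] :
    ∃ f : S →ₗ[k] C ⊗[k] S, (∀ s, act ρ (f s) = s) ∧ ∀ c s, f (ρ c s) = c • f s := by
  obtain ⟨f, hf⟩ := Module.projective_lifting_property (actHom ρ) LinearMap.id
    (actHom_surjective ρ)
  have hc (c : C) (s : S) : f ((equiv ρ).symm (ρ c s)) = c • f ((equiv ρ).symm s) :=
    f.map_smul c _
  refine ⟨{ toFun := fun s => f ((equiv ρ).symm s)
            map_add' := fun s t => by simp
            map_smul' := fun r s => ?_ }, fun s => DFunLike.congr_fun hf s, hc⟩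
  have := hc (algebraMap k C r) s
  rwa [AlgHom.commutes, Module.algebraMap_end_apply, algebraMap_smul] at this

theorem projective (h : IsDeformation π σ ρ₁ ρ₂) (hπ : IsConnectedGrading π ε)
    (hσ : IsGrading σ) [Module.Projective C (ActionModule ρ₁)] :
    Module.Projective C (ActionModule ρ₂) := by
  obtain ⟨f, hf, hfc⟩ := exists_linearMap_section ρ₁
  obtain ⟨g, hg⟩ := hσ.exists_linearMap fun p => tensorProj π σ p ∘ₗ f
  have hgc (c : C) (s : S) : g (ρ₁ c s) = c • g s := by
    refine hπ.induction_on c (by simp) (fun c d hc hd => ?_) fun i c hc => ?_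
    · simp only [map_add, LinearMap.add_apply, hc, hd, add_smul]
    · refine hσ.induction_on s (by simp) (fun s t hs ht => ?_) fun j s hs => ?_
      · simp only [map_add, hs, ht, smul_add]
      · rw [hg _ _ (h.graded i c j s hc hs), hg _ _ hs, LinearMap.comp_apply, hfc,
          hπ.tensorProj_smul hσ hc]
        rfl
  have hbij : Function.Bijective (act ρ₂ ∘ₗ g) := by
    refine hσ.bijective_of_sub_mem_degreeLT _ fun p s hs => ?_
    have hgs : act ρ₁ (g s) = s := by
      rw [hg p s hs, LinearMap.comp_apply, h.act_tensorProj hπ hσ, hf, hs]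
    have hgp : tensorProj π σ p (g s) = g s := by
      rw [hg p s hs, LinearMap.comp_apply, (hπ.tensor hσ).proj_proj, if_pos rfl]
    simpa [hgs] using h.act_sub_act_mem hπ hσ hgp
  let θ : ActionModule ρ₁ →ₗ[C] ActionModule ρ₂ :=
    { toFun := fun s => (equiv ρ₂).symm (act ρ₂ (g (equiv ρ₁ s)))
      map_add' := fun s t => by simp
      map_smul' := fun c s => (equiv ρ₂).injective (by simp [hgc, act_smul]) }
  exact Module.Projective.of_equiv (LinearEquiv.ofBijective θ hbij)

theorem projDimLE (n : ℕ) (h : IsDeformation π σ ρ₁ ρ₂) (hπ : IsConnectedGrading π ε)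
    (hσ : IsGrading σ) (hn : ProjDimLE C (ActionModule ρ₁) n) :
    ProjDimLE C (ActionModule ρ₂) n := by
  induction n generalizing S with
  | zero =>
    rw [ProjDimLE.zero_iff] at hn ⊢
    exact h.projective hπ hσ
  | succ n ih =>
    rw [projDimLE_succ_iff _ ε] at hn ⊢
    exact ih (h.syzygyAction hπ hσ) ((isGrading_augmentationGrading hπ).tensor hσ) hn

end IsDeformation

/-- The action of `C` on a vector space through its augmentation. -/
def trivialAction (ε : C →ₐ[k] k) (V : Type) [AddCommGroup V] [Module k V] :
    C →ₐ[k] Module.End k V :=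
  (Algebra.ofId k (Module.End k V)).comp ε

@[simp]
theorem trivialAction_apply (ε : C →ₐ[k] k) (c : C) (v : V) :
    trivialAction ε V c v = ε c • v := rfl

theorem IsConnectedGrading.projDimLE_of_trivialAction {π : ℕ → C →ₗ[k] C} {ε : C →ₐ[k] k}
    (hπ : IsConnectedGrading π ε) (n : ℕ)
    (h : ∀ (V : Type) [AddCommGroup V] [Module k V],
      ProjDimLE C (ActionModule (trivialAction ε V)) n)
    (M : Type) [AddCommGroup M] [Module C M] : ProjDimLE C M n := by
  let : Module k M := Module.compHom M (algebraMap k C)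
  have : IsScalarTower k C M := ⟨fun r c m => by
    rw [Algebra.smul_def, mul_smul]; rfl⟩
  let σ : ℕ → M →ₗ[k] M := fun p => if p = 0 then LinearMap.id else 0
  have hσ : IsGrading σ :=
    { proj_proj := fun p q v => by
        by_cases hp : p = 0 <;> by_cases hq : q = 0 <;> simp [σ, hp, hq]
      sum_proj := fun v => ⟨1, fun N hN => by
        rw [Finset.sum_eq_single_of_mem 0 (by simp; lia) (fun p _ hp => by simp [σ, hp])]
        simp [σ]⟩ }
  have hdef : IsDeformation π σ (trivialAction ε M) (Algebra.lsmul k k M) := by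
    constructor
    · intro i c j s hc hs
      by_cases hi : i = 0
      · simp [hi, hs]
      · simp [hπ.augmentation_eq_zero hc hi]
    · intro i c j s hc hs
      by_cases hi : i = 0
      · subst hi
        rw [hπ.eq_algebraMap hc]
        simp
      · exact mem_degreeLT.2 fun q hq => by simp [σ, show q ≠ 0 by lia]
  exact (hdef.projDimLE n hπ hσ (h M)).of_equiv
    { (ActionModule.equiv (Algebra.lsmul k k M : C →ₐ[k] Module.End k M)) with
      map_smul' := fun c m => rfl }

end Deformation

section NormalQuotient

variable {A B : Type} [Ring A] [Ring B]

/-- `q : B → A` is the quotient of `B` by a regular normal element `z`. -/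
structure IsRegularNormalQuotient (q : B →+* A) (z : B) : Prop where
  surjective : Function.Surjective q
  map_eq_zero_iff : ∀ b, q b = 0 ↔ ∃ b', b = z * b'
  regular : IsRegular z
  normal : IsNormalElem z

namespace IsRegularNormalQuotient

variable {q : B →+* A} {z : B} (h : IsRegularNormalQuotient q z)
include h

theorem map_self : q z = 0 := (h.map_eq_zero_iff z).2 ⟨1, by simp⟩

theorem eq_zero_of_mul_eq_zero {b : B} (hb : z * b = 0) : b = 0 :=
  h.regular.left (by simpa using hb)

theorem eq_zero_of_smul_eq_zero {I : Type} {x : I →₀ B} (hx : z • x = 0) : x = 0 :=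
  Finsupp.ext fun i => h.eq_zero_of_mul_eq_zero (DFunLike.congr_fun hx i)

theorem exists_eq_smul {I : Type} {x : I →₀ B} (hx : ∀ i, q (x i) = 0) : ∃ y, x = z • y := by
  choose y hy using fun i => (h.map_eq_zero_iff (x i)).1 (hx i)
  refine ⟨Finsupp.onFinset x.support y fun i hi => ?_, Finsupp.ext fun i => hy i⟩
  rw [Finsupp.mem_support_iff, hy]
  exact fun hz => hi (h.eq_zero_of_mul_eq_zero hz)

theorem exists_eq_mapRange_mul {I : Type} {x : I →₀ B} (hx : ∀ i, q (x i) = 0) :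
    ∃ y, x = Finsupp.mapRange (· * z) (zero_mul z) y := by
  have H (i : I) : ∃ b, x i = b * z := by
    obtain ⟨b, hb⟩ := (h.map_eq_zero_iff (x i)).1 (hx i)
    obtain ⟨c, hc⟩ := h.normal.1 b
    exact ⟨c, hb.trans hc⟩
  choose y hy using H
  refine ⟨Finsupp.onFinset x.support y fun i hi => ?_, Finsupp.ext fun i => hy i⟩
  rw [Finsupp.mem_support_iff, hy]
  exact fun hz => hi (h.regular.right (by simpa using hz))

theorem projective_of_semilinear {N Q : Type} [AddCommGroup N] [Module B N] [AddCommGroup Q]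
    [Module A Q] (g : N →ₛₗ[q] Q) (hg : Function.Surjective g)
    (hker : ∀ x, g x = 0 ↔ ∃ y, x = z • y) [Module.Projective B N] : Module.Projective A Q := by
  refine Module.Projective.of_lifting_property'' fun f hf => ?_
  let : Module B Q := Module.compHom Q q
  let : Module B (Q →₀ A) := Module.compHom (Q →₀ A) q
  let f' : (Q →₀ A) →ₗ[B] Q :=
    { f with map_smul' := fun b x => f.map_smul (q b) x }
  let g' : N →ₗ[B] Q :=
    { g with map_smul' := fun b x => g.map_smulₛₗ b x }
  obtain ⟨l, hl⟩ := Module.projective_lifting_property f' g' hf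
  have hzl (x : N) (hx : g x = 0) : l x = 0 := by
    obtain ⟨y, rfl⟩ := (hker x).1 hx
    rw [map_smul]
    change q z • l y = 0
    rw [h.map_self, zero_smul]
  have hgl {x y : N} (hxy : g x = g y) : l x = l y := by
    rw [← sub_eq_zero, ← map_sub]
    exact hzl _ (by rw [map_sub, hxy, sub_self])
  choose s hs using hg
  have hsl (x : N) : l (s (g x)) = l x := hgl (hs _)
  refine ⟨{ toFun := fun y => l (s y), map_add' := fun y y' => ?_, map_smul' := fun a y => ?_ },
    LinearMap.ext fun y => ?_⟩
  · rw [← map_add]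
    exact hgl (by simp [hs])
  · obtain ⟨b, rfl⟩ := h.surjective a
    refine (hgl ?_).trans (l.map_smul b (s y))
    rw [hs, map_smulₛₗ, hs]
  · exact (DFunLike.congr_fun hl (s y)).trans (hs y)

theorem projDimLE_of_semilinear (n : ℕ) {N Q : Type} [AddCommGroup N] [Module B N]
    [AddCommGroup Q] [Module A Q] (g : N →ₛₗ[q] Q) (hg : Function.Surjective g)
    (hker : ∀ x, g x = 0 ↔ ∃ y, x = z • y) (hN : ∀ x : N, z • x = 0 → x = 0)
    (hn : ProjDimLE B N n) : ProjDimLE A Q n := by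
  induction n generalizing N Q with
  | zero =>
    rw [ProjDimLE.zero_iff] at hn ⊢
    exact h.projective_of_semilinear g hg hker
  | succ n ih =>
    let f : (N →₀ B) →ₗ[B] N := Finsupp.linearCombination B id
    let f' : (N →₀ A) →ₗ[A] Q := Finsupp.linearCombination A g
    let γ : (N →₀ B) →ₛₗ[q] (N →₀ A) := Finsupp.mapRange.linearMap q.toSemilinearMap
    have hf : Function.Surjective f := Finsupp.linearCombination_surjective B fun x => ⟨x, rfl⟩
    have hf' : Function.Surjective f' := Finsupp.linearCombination_surjective A hg
    have hγ : Function.Surjective γ := Finsupp.mapRange_surjective q (map_zero q) h.surjective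
    have hγf (x : N →₀ B) : f' (γ x) = g (f x) := by
      induction x using Finsupp.induction_linear with
      | zero => simp
      | add x y hx hy => simp only [map_add, hx, hy]
      | single i b => simp [f, f', γ]
    rw [ProjDimLE.succ_iff _ f (Submodule.subtype_injective _) hf f.exact_subtype_ker_map] at hn
    rw [ProjDimLE.succ_iff _ f' (Submodule.subtype_injective _) hf' f'.exact_subtype_ker_map]
    let g' : LinearMap.ker f →ₛₗ[q] LinearMap.ker f' :=
      (γ ∘ₛₗ (LinearMap.ker f).subtype).codRestrict _ fun x => by
        have hx : f x = 0 := x.2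
        simp [hγf, hx]
    refine ih g' ?_ ?_ ?_ hn
    · rintro ⟨y, hy⟩
      obtain ⟨x, rfl⟩ := hγ y
      have hx : g (f x) = 0 := (hγf x).symm.trans hy
      obtain ⟨w, hw⟩ := (hker _).1 hx
      obtain ⟨x', rfl⟩ := hf w
      refine ⟨⟨x - z • x', by simp [hw]⟩, Subtype.ext ?_⟩
      change γ (x - z • x') = γ x
      rw [map_sub, map_smulₛₗ, h.map_self, zero_smul, sub_zero]
    · rintro ⟨x, hx⟩
      constructor
      · intro hx0
        have hx0 : γ x = 0 := congrArg Subtype.val hx0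
        obtain ⟨y, rfl⟩ := h.exists_eq_smul fun i => DFunLike.congr_fun hx0 i
        have hy : z • f y = 0 := (f.map_smul z y).symm.trans hx
        exact ⟨⟨y, hN _ hy⟩, rfl⟩
      · rintro ⟨y, hy⟩
        rw [hy, map_smulₛₗ, h.map_self, zero_smul]
    · exact fun x hx => Subtype.ext (h.eq_zero_of_smul_eq_zero (congrArg Subtype.val hx))

theorem projDimLE_finsupp {I : Type} [Module B (I →₀ A)]
    (hI : ∀ (b : B) (x : I →₀ A), b • x = q b • x) : ProjDimLE B (I →₀ A) 1 := by
  let i : (I →₀ B) →ₗ[B] (I →₀ B) := Finsupp.mapRange.linearMap (LinearMap.toSpanSingleton B B z)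
  let f : (I →₀ B) →ₗ[B] (I →₀ A) :=
    { Finsupp.mapRange.linearMap q.toSemilinearMap with
      map_smul' := fun b x => by
        rw [RingHom.id_apply, hI]
        exact LinearMap.map_smulₛₗ (Finsupp.mapRange.linearMap q.toSemilinearMap) b x }
  refine ProjDimLE.of_exact i f (Finsupp.mapRange_injective (· * z) (zero_mul z) h.regular.right)
    (Finsupp.mapRange_surjective q (map_zero q) h.surjective) (fun x => ⟨fun hx => ?_, ?_⟩)
    (ProjDimLE.of_projective 0) (ProjDimLE.of_projective 1)
  · obtain ⟨y, rfl⟩ := h.exists_eq_mapRange_mul fun i => DFunLike.congr_fun hx i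
    exact ⟨y, rfl⟩
  · rintro ⟨y, rfl⟩
    refine Finsupp.ext fun i => ?_
    change q (y i * z) = 0
    rw [map_mul, h.map_self, mul_zero]

theorem projDimLE_succ (n : ℕ) {M : Type} [AddCommGroup M] [Module A M] [Module B M]
    (hM : ∀ (b : B) (m : M), b • m = q b • m) (hn : ProjDimLE A M n) :
    ProjDimLE B M (n + 1) := by
  induction n generalizing M with
  | zero =>
    rw [ProjDimLE.zero_iff] at hn
    obtain ⟨s, hs⟩ := Module.projective_def'.1 hn
    let : Module B (M →₀ A) := Module.compHom (M →₀ A) q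
    have hF (b : B) (x : M →₀ A) : b • x = q b • x := rfl
    exact (h.projDimLE_finsupp hF).of_retract
      { s with map_smul' := fun b m => (congrArg s (hM b m)).trans (s.map_smul (q b) m) }
      { Finsupp.linearCombination A (id : M → M) with
        map_smul' := fun b x => (LinearMap.map_smul _ (q b) x).trans (hM b _).symm }
      (LinearMap.ext fun m => DFunLike.congr_fun hs m)
  | succ n ih =>
    let f : (M →₀ A) →ₗ[A] M := Finsupp.linearCombination A id
    have hf : Function.Surjective f := Finsupp.linearCombination_surjective A fun x => ⟨x, rfl⟩
    rw [ProjDimLE.succ_iff _ f (Submodule.subtype_injective _) hf f.exact_subtype_ker_map] at hn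
    let : Module B (M →₀ A) := Module.compHom (M →₀ A) q
    have hF (b : B) (x : M →₀ A) : b • x = q b • x := rfl
    let : Module B (LinearMap.ker f) := Module.compHom (LinearMap.ker f) q
    let i : LinearMap.ker f →ₗ[B] (M →₀ A) :=
      { (LinearMap.ker f).subtype with map_smul' := fun b x => rfl }
    let f' : (M →₀ A) →ₗ[B] M :=
      { f with map_smul' := fun b x => (f.map_smul (q b) x).trans (hM b _).symm }
    exact ProjDimLE.of_exact i f' (Submodule.subtype_injective _) hf
      f.exact_subtype_ker_map (ih (fun b x => rfl) hn)
      ((h.projDimLE_finsupp hF).mono (by lia))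

end IsRegularNormalQuotient

end NormalQuotient

section ConnectedQuotient

open ActionModule

variable {k : Type} [Field k]

/-- The augmentation of a free module. -/
def augmentationHom {C : Type} [Ring C] [Algebra k C] (ε : C →ₐ[k] k) (I : Type) :
    (I →₀ C) →ₗ[C] ActionModule (trivialAction ε (I →₀ k)) where
  toFun x := (equiv _).symm (Finsupp.mapRange.linearMap ε.toLinearMap x)
  map_add' x y := by rw [map_add, map_add]
  map_smul' c x := (equiv _).injective <| by
    simp only [AddEquiv.apply_symm_apply, equiv_smul, RingHom.id_apply]
    ext i
    simp

theorem mem_ker_augmentationHom {C : Type} [Ring C] [Algebra k C] (ε : C →ₐ[k] k) {I : Type}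
    (x : I →₀ C) : x ∈ LinearMap.ker (augmentationHom ε I) ↔ ∀ i, ε (x i) = 0 := by
  rw [LinearMap.mem_ker, ← (equiv _).map_eq_zero_iff, Finsupp.ext_iff]
  rfl

theorem augmentationHom_surjective {C : Type} [Ring C] [Algebra k C] (ε : C →ₐ[k] k) (I : Type) :
    Function.Surjective (augmentationHom ε I) :=
  Finsupp.mapRange_surjective ε (map_zero ε) fun c => ⟨algebraMap k C c, by simp⟩

variable {A B : Type} [Ring A] [Algebra k A] [Ring B] [Algebra k B]

theorem IsRegularNormalQuotient.projDimLE_trivialAction_finsupp {q : B →ₐ[k] A} {z : B}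
    (h : IsRegularNormalQuotient (q : B →+* A) z) {ε : B →ₐ[k] k} {ε' : A →ₐ[k] k}
    (hε : ∀ b, ε' (q b) = ε b) (lam : B →ₗ[k] k) (hz : ∀ b, lam (z * b) = ε b)
    (hlam : ∀ b x, ε x = 0 → lam (b * x) = ε b * lam x) {n : ℕ} (hB : GlobalDimLE B (n + 1))
    (I : Type) : ProjDimLE A (ActionModule (trivialAction ε' (I →₀ k))) n := by
  have hn := (globalDimLE_iff_projDimLE B _).1 hB (ActionModule (trivialAction ε (I →₀ k)))
  rw [ProjDimLE.succ_iff _ _ (Submodule.subtype_injective _) (augmentationHom_surjective ε I)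
    (augmentationHom ε I).exact_subtype_ker_map] at hn
  have hq : q z = 0 := h.map_self
  have hεz : ε z = 0 := by rw [← hε, hq, map_zero]
  let T := ActionModule (trivialAction ε' (I →₀ k))
  let L : (I →₀ B) →ₗ[k] (I →₀ k) := Finsupp.mapRange.linearMap lam
  let Γ : (I →₀ B) →ₛₗ[(q : B →+* A)] (I →₀ A) :=
    Finsupp.mapRange.linearMap (q : B →+* A).toSemilinearMap
  let g₁ : LinearMap.ker (augmentationHom ε I) →ₛₗ[(q : B →+* A)] T :=
    { toFun := fun x => (equiv _).symm (L x)
      map_add' := fun x y => by simp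
      map_smul' := fun b x => (equiv _).injective <| Finsupp.ext fun i => by
        have hx := (mem_ker_augmentationHom ε (x : I →₀ B)).1 x.2 i
        simp [L, T, hlam _ _ hx, hε] }
  let g₂ : LinearMap.ker (augmentationHom ε I) →ₛₗ[(q : B →+* A)]
      LinearMap.ker (augmentationHom ε' I) :=
    (Γ ∘ₛₗ (LinearMap.ker (augmentationHom ε I)).subtype).codRestrict _ fun x => by
      rw [mem_ker_augmentationHom]
      exact fun i => (hε _).trans ((mem_ker_augmentationHom ε (x : I →₀ B)).1 x.2 i)
  let g : LinearMap.ker (augmentationHom ε I) →ₛₗ[(q : B →+* A)]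
      T × LinearMap.ker (augmentationHom ε' I) :=
    { toFun := fun x => (g₁ x, g₂ x)
      map_add' := fun x y => Prod.ext (map_add g₁ x y) (map_add g₂ x y)
      map_smul' := fun b x => Prod.ext (map_smulₛₗ g₁ b x) (map_smulₛₗ g₂ b x) }
  have hQ : ProjDimLE A (T × LinearMap.ker (augmentationHom ε' I)) n := by
    refine h.projDimLE_of_semilinear n g ?_ ?_ ?_ hn
    · rintro ⟨v, y, hy⟩
      obtain ⟨x, rfl⟩ : ∃ x, Γ x = y := Finsupp.mapRange_surjective q (map_zero q) h.surjective y
      rw [mem_ker_augmentationHom] at hy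
      let w : I →₀ B := Finsupp.mapRange.linearMap (Algebra.linearMap k B) (equiv _ v - L x)
      refine ⟨⟨x + z • w, ?_⟩, Prod.ext ?_ ?_⟩
      · rw [mem_ker_augmentationHom]
        intro i
        have : ε (x i) = 0 := (hε _).symm.trans (hy i)
        simp [this, hεz]
      · refine (equiv _).injective (Finsupp.ext fun i => ?_)
        change lam ((x + z • w) i) = _
        simp [w, L, hz]
      · refine Subtype.ext (Finsupp.ext fun i => ?_)
        change q ((x + z • w) i) = q (x i)
        simp [hq]
    · rintro ⟨x, hx⟩
      constructor
      · intro hx0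
        have h₁ : L x = 0 := congrArg (fun y => equiv _ y.1) hx0
        have h₂ : Γ x = 0 := congrArg (fun y => (y.2 : I →₀ A)) hx0
        obtain ⟨y, rfl⟩ := h.exists_eq_smul fun i => DFunLike.congr_fun h₂ i
        refine ⟨⟨y, (mem_ker_augmentationHom ε y).2 fun i => ?_⟩, rfl⟩
        exact (hz (y i)).symm.trans (DFunLike.congr_fun h₁ i)
      · rintro ⟨y, hy⟩
        have : (q : B →+* A) z = 0 := hq
        rw [hy, map_smulₛₗ, this, zero_smul]
    · exact fun x hx => Subtype.ext (h.eq_zero_of_smul_eq_zero (congrArg Subtype.val hx))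
  exact hQ.of_retract (LinearMap.inl A _ _) (LinearMap.fst A _ _) (LinearMap.fst_comp_inl A _ _)

theorem ProjDimLE.trivialAction_of_finsupp {C : Type} [Ring C] [Algebra k C] {ε : C →ₐ[k] k}
    {n : ℕ} (h : ∀ I : Type, ProjDimLE C (ActionModule (trivialAction ε (I →₀ k))) n)
    (V : Type) [AddCommGroup V] [Module k V] : ProjDimLE C (ActionModule (trivialAction ε V)) n :=
  let e := (Module.Basis.ofVectorSpace k V).repr
  (h _).of_equiv
    { ((equiv _).trans e.symm.toAddEquiv).trans (equiv _).symm with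
      map_smul' := fun c v => e.symm.map_smul (ε c) v }

theorem IsConnectedGrading.exists_leadingCoeff {π : ℕ → B →ₗ[k] B} {ε : B →ₐ[k] k}
    (hπ : IsConnectedGrading π ε) {z : B} (hz : π 1 z = z) (hz0 : z ≠ 0) :
    ∃ lam : B →ₗ[k] k, (∀ b, lam (z * b) = ε b) ∧
      ∀ b x, ε x = 0 → lam (b * x) = ε b * lam x := by
  obtain ⟨f, hf⟩ : ∃ f : B →ₗ[k] k, f z = 1 := by
    obtain ⟨f, hf⟩ := (LinearMap.toSpanSingleton k B z).exists_leftInverse_of_injective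
      (LinearMap.ker_toSpanSingleton k hz0)
    exact ⟨f, by simpa using DFunLike.congr_fun hf 1⟩
  have hmul (b x : B) : π 1 (b * x) = ε b • π 1 x + ε x • π 1 b := by
    refine hπ.induction_on b (by simp) (fun b c hb hc => ?_) fun i b hb => ?_
    · simp only [add_mul, map_add, hb, hc, add_smul, smul_add]
      abel
    refine hπ.induction_on x (by simp) (fun b c hb hc => ?_) fun j x hx => ?_
    · simp only [mul_add, map_add, hb, hc, add_smul, smul_add]
      abel
    by_cases hi : i = 0
    · subst hi
      rw [hπ.proj_of_homogeneous hb, if_neg one_ne_zero, smul_zero, add_zero,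
        hπ.eq_algebraMap hb, ← Algebra.smul_def, map_smul, AlgHom.commutes, Algebra.algebraMap_self,
        RingHom.id_apply]
    rw [hπ.augmentation_eq_zero hb hi, zero_smul, zero_add]
    by_cases hj : j = 0
    · subst hj
      rw [hπ.eq_algebraMap hx, ← Algebra.commutes, ← Algebra.smul_def, map_smul, AlgHom.commutes,
        Algebra.algebraMap_self, RingHom.id_apply]
    · rw [hπ.augmentation_eq_zero hx hj, zero_smul,
        hπ.proj_of_homogeneous (hπ.mul i b j x hb hx), if_neg (by lia)]
  refine ⟨f ∘ₗ π 1, fun b => ?_, fun b x hx => ?_⟩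
  · simp [hmul, hπ.augmentation_eq_zero hz, hz, hf]
  · simp [hmul, hx]

theorem IsRegularNormalQuotient.globalDimLE {q : B →ₐ[k] A} {z : B}
    (h : IsRegularNormalQuotient (q : B →+* A) z) {π : ℕ → B →ₗ[k] B} {ε : B →ₐ[k] k}
    (hπ : IsConnectedGrading π ε) (hz : π 1 z = z) {π' : ℕ → A →ₗ[k] A} {ε' : A →ₐ[k] k}
    (hπ' : IsConnectedGrading π' ε') (hε : ∀ b, ε' (q b) = ε b) {n : ℕ}
    (hB : GlobalDimLE B (n + 1)) : GlobalDimLE A n := by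
  have : Nontrivial B := ε.toRingHom.domain_nontrivial
  obtain ⟨lam, h₁, h₂⟩ := hπ.exists_leadingCoeff hz h.regular.left.ne_zero
  rw [globalDimLE_iff_projDimLE]
  exact hπ'.projDimLE_of_trivialAction n (ProjDimLE.trivialAction_of_finsupp
    (h.projDimLE_trivialAction_finsupp hε lam h₁ h₂ hB))

theorem IsRegularNormalQuotient.globalDimLE_succ {q : B →ₐ[k] A} {z : B}
    (h : IsRegularNormalQuotient (q : B →+* A) z) {π : ℕ → B →ₗ[k] B} {ε : B →ₐ[k] k}
    (hπ : IsConnectedGrading π ε) {ε' : A →ₐ[k] k} (hε : ∀ b, ε' (q b) = ε b) {n : ℕ}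
    (hA : GlobalDimLE A n) : GlobalDimLE B (n + 1) := by
  rw [globalDimLE_iff_projDimLE] at hA ⊢
  refine hπ.projDimLE_of_trivialAction (n + 1) fun V _ _ => ?_
  let : Module A (ActionModule (trivialAction ε V)) :=
    inferInstanceAs (Module A (ActionModule (trivialAction ε' V)))
  refine h.projDimLE_succ n (fun b m => ?_) (hA _)
  change ε b • equiv _ m = ε' (q b) • equiv _ m
  rw [hε]

end ConnectedQuotient

section GradedQuotient

variable {k : Type} [Field k] {A B : Type} [Ring A] [Algebra k A] [Ring B] [Algebra k B]

theorem GradedAlgebra.isGrading_proj (𝒜 : ℕ → Submodule k B) [GradedAlgebra 𝒜] :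
    IsGrading (GradedAlgebra.proj 𝒜) where
  proj_proj p q b := by
    have hb : GradedAlgebra.proj 𝒜 q b ∈ 𝒜 q := SetLike.coe_mem _
    rw [GradedAlgebra.proj_apply 𝒜 p]
    split_ifs with h
    · subst h
      exact DirectSum.decompose_of_mem_same 𝒜 hb
    · exact DirectSum.decompose_of_mem_ne 𝒜 hb (Ne.symm h)
  sum_proj b := by
    classical
    obtain ⟨N, hN⟩ := (DirectSum.decompose 𝒜 b).support.bddAbove
    refine ⟨N + 1, fun M hM => Eq.trans ?_ (DirectSum.sum_support_decompose 𝒜 b)⟩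
    refine (Finset.sum_subset (fun i hi => ?_) fun i _ hi => ?_).symm
    · have := hN hi
      simp
      lia
    · simpa using hi

theorem GradedAlgebra.proj_eq_self_iff (𝒜 : ℕ → Submodule k B) [GradedAlgebra 𝒜] {p : ℕ} {b : B} :
    GradedAlgebra.proj 𝒜 p b = b ↔ b ∈ 𝒜 p :=
  ⟨fun h => h ▸ SetLike.coe_mem _, DirectSum.decompose_of_mem_same 𝒜⟩

theorem GradedAlgebra.exists_isConnectedGrading [Nontrivial B] (𝒜 : ℕ → Submodule k B)
    [GradedAlgebra 𝒜] (hconn : ∀ a ∈ 𝒜 0, ∃ c : k, a = algebraMap k B c) :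
    ∃ ε : B →ₐ[k] k, IsConnectedGrading (GradedAlgebra.proj 𝒜) ε := by
  have hinj : Function.Injective (algebraMap k B) := FaithfulSMul.algebraMap_injective k B
  have hex (b : B) : ∃ c : k, GradedRing.projZeroRingHom 𝒜 b = algebraMap k B c :=
    hconn _ (SetLike.coe_mem _)
  choose f hf using hex
  let ε : B →+* k :=
    { toFun := f
      map_one' := hinj (by rw [← hf, map_one, map_one])
      map_mul' := fun a b => hinj (by rw [← hf, map_mul, map_mul, ← hf, ← hf])
      map_zero' := hinj (by rw [← hf, map_zero, map_zero])
      map_add' := fun a b => hinj (by rw [← hf, map_add, map_add, ← hf, ← hf]) }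
  refine ⟨{ ε with commutes' := fun c => hinj ((hf _).symm.trans ?_) },
    { toIsGrading := GradedAlgebra.isGrading_proj 𝒜, mul := fun i a j b ha hb => ?_,
      proj_zero := fun a => hf a }⟩
  · exact DirectSum.decompose_of_mem_same 𝒜 (SetLike.algebraMap_mem_graded 𝒜 c)
  · rw [GradedAlgebra.proj_eq_self_iff] at ha hb ⊢
    exact SetLike.mul_mem_graded ha hb

theorem IsConnectedGrading.exists_quotient {π : ℕ → B →ₗ[k] B} {ε : B →ₐ[k] k}
    (hπ : IsConnectedGrading π ε) {z : B} (hz : π 1 z = z) {q : B →ₐ[k] A}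
    (h : IsRegularNormalQuotient (q : B →+* A) z) :
    ∃ (π' : ℕ → A →ₗ[k] A) (ε' : A →ₐ[k] k),
      IsConnectedGrading π' ε' ∧ ∀ b, ε' (q b) = ε b := by
  have hsurj : Function.Surjective q := h.surjective
  have hqz : q z = 0 := h.map_self
  obtain ⟨s, hs⟩ := q.toLinearMap.exists_rightInverse_of_surjective
    (LinearMap.range_eq_top.2 hsurj)
  have hs (b : B) : q (s (q b) - b) = 0 := by
    rw [map_sub, sub_eq_zero]
    exact DFunLike.congr_fun hs (q b)
  have hεker (b : B) (hb : q b = 0) : ε b = 0 := by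
    obtain ⟨c, rfl⟩ := (h.map_eq_zero_iff b).1 hb
    rw [map_mul, hπ.augmentation_eq_zero hz one_ne_zero, zero_mul]
  have hπker (p : ℕ) (b : B) (hb : q b = 0) : q (π p b) = 0 := by
    obtain ⟨c, rfl⟩ := (h.map_eq_zero_iff b).1 hb
    refine hπ.induction_on c (by simp) (fun c d hc hd => ?_) fun i c hc => ?_
    · rw [mul_add, map_add, map_add, hc, hd, add_zero]
    · rw [hπ.proj_of_homogeneous (hπ.mul 1 z i c hz hc)]
      split_ifs <;> simp [hqz]
  let e : A →ₗ[k] k := ε.toLinearMap ∘ₗ s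
  let π' : ℕ → A →ₗ[k] A := fun p => q.toLinearMap ∘ₗ π p ∘ₗ s
  have he (b : B) : e (q b) = ε b := by
    rw [← sub_eq_zero]
    exact (map_sub ε _ _).symm.trans (hεker _ (hs b))
  have hπ' (p : ℕ) (b : B) : π' p (q b) = q (π p b) := by
    rw [← sub_eq_zero]
    change q (π p (s (q b))) - q (π p b) = 0
    rw [← map_sub, ← map_sub]
    exact hπker p _ (hs b)
  have hhom (i : ℕ) (a : A) (ha : π' i a = a) : ∃ b, π i b = b ∧ q b = a := by
    obtain ⟨b, rfl⟩ := hsurj a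
    exact ⟨π i b, by simp [hπ.proj_proj], (hπ' i b).symm.trans ha⟩
  refine ⟨π', AlgHom.ofLinearMap e ?_ fun a b => ?_,
    { proj_proj := fun p r a => ?_, sum_proj := fun a => ?_, mul := fun i a j b ha hb => ?_,
      proj_zero := fun a => ?_ }, he⟩
  · rw [← map_one q, he, map_one]
  · obtain ⟨a, rfl⟩ := hsurj a
    obtain ⟨b, rfl⟩ := hsurj b
    rw [← map_mul, he, he, he, map_mul]
  · obtain ⟨a, rfl⟩ := hsurj a
    rw [hπ', hπ', hπ.proj_proj]
    split_ifs <;> simp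
  · obtain ⟨a, rfl⟩ := hsurj a
    obtain ⟨N, hN⟩ := hπ.sum_proj a
    refine ⟨N, fun M hM => ?_⟩
    simp only [hπ', ← map_sum, hN M hM]
  · obtain ⟨a, ha', rfl⟩ := hhom i a ha
    obtain ⟨b, hb', rfl⟩ := hhom j b hb
    rw [← map_mul, hπ', hπ.mul i a j b ha' hb']
  · obtain ⟨a, rfl⟩ := hsurj a
    rw [hπ', hπ.proj_zero, AlgHom.commutes]
    exact congrArg _ (he a).symm

theorem isRegularNormalQuotient_ringQuot {z : B} (hreg : IsRegular z) (hnorm : IsNormalElem z) :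
    IsRegularNormalQuotient
      (RingQuot.mkAlgHom k (fun a b : B => a = z ∧ b = 0) :
        B →+* RingQuot fun a b : B => a = z ∧ b = 0) z := by
  let I : Ideal B :=
    { carrier := {b | ∃ c, b = z * c}
      zero_mem' := ⟨0, by simp⟩
      add_mem' := by
        rintro _ _ ⟨c, rfl⟩ ⟨d, rfl⟩
        exact ⟨c + d, (mul_add z c d).symm⟩
      smul_mem' := by
        rintro a _ ⟨c, rfl⟩
        obtain ⟨b, hb⟩ := hnorm.2 a
        exact ⟨b * c, by rw [smul_eq_mul, ← mul_assoc, hb, mul_assoc]⟩ }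
  have : I.IsTwoSided := ⟨by
    rintro _ b ⟨c, rfl⟩
    exact ⟨c * b, mul_assoc z c b⟩⟩
  have hw : ∀ ⦃x y : B⦄, x = z ∧ y = 0 → Ideal.Quotient.mkₐ k I x = Ideal.Quotient.mkₐ k I y := by
    rintro x _ ⟨rfl, rfl⟩
    have hx : x ∈ I := ⟨1, (mul_one x).symm⟩
    exact (Ideal.Quotient.eq_zero_iff_mem.2 hx).trans (map_zero _).symm
  have hz : RingQuot.mkAlgHom k (fun a b : B => a = z ∧ b = 0) z = 0 :=
    (RingQuot.mkAlgHom_rel k ⟨rfl, rfl⟩).trans (map_zero _)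
  refine ⟨RingQuot.mkAlgHom_surjective k _, fun b => ⟨fun hb => ?_, ?_⟩, hreg, hnorm⟩
  · have := RingQuot.liftAlgHom_mkAlgHom_apply k (Ideal.Quotient.mkₐ k I) hw b
    rw [show RingQuot.mkAlgHom k (fun a b : B => a = z ∧ b = 0) b = 0 from hb, map_zero] at this
    exact Ideal.Quotient.eq_zero_iff_mem.1 this.symm
  · rintro ⟨c, rfl⟩
    rw [map_mul]
    exact (congrArg (· * _) hz).trans (zero_mul _)

theorem IsRegularNormalQuotient.not_globalDimLE_zero [Nontrivial A] {q : B →+* A} {z : B}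
    (h : IsRegularNormalQuotient q z) : ¬ GlobalDimLE B 0 := by
  intro hB
  let : Module B A := Module.compHom A q
  have := ProjDimLE.zero_iff.1 ((globalDimLE_iff_projDimLE B 0).1 hB A)
  let f : B →ₗ[B] A := { q with map_smul' := fun b c => map_mul q b c }
  obtain ⟨s, hs⟩ := Module.projective_lifting_property f LinearMap.id h.surjective
  have hz : z * s 1 = 0 := by
    rw [← smul_eq_mul, ← map_smul]
    change s (q z * 1) = 0
    rw [h.map_self, zero_mul, map_zero]
  have h₁ : f (s 1) = 1 := DFunLike.congr_fun hs 1
  rw [h.eq_zero_of_mul_eq_zero hz, map_zero] at h₁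
  exact zero_ne_one h₁

theorem globalDimLE_zero_of_subsingleton (R : Type) [Ring R] [Subsingleton R] :
    GlobalDimLE R 0 :=
  (globalDimLE_iff_projDimLE R 0).2 fun M _ _ =>
    have := Module.subsingleton R M
    ProjDimLE.of_projective 0

end GradedQuotient

/-- let `B` be a connected `ℕ`-graded algebra over a field `k`, generated in
degree 1, of finite global dimension `d`, and let `z ∈ B₁` be a regular normal element.
Then `B/(z)` has global dimension `d - 1`. -/
theorem globalDim_quotient_by_regular_normal_degree_one
    (k : Type) [Field k] (B : Type) [Ring B] [Algebra k B]
    (𝒜 : ℕ → Submodule k B) [GradedAlgebra 𝒜]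
    (hconn : ∀ a ∈ 𝒜 0, ∃ c : k, a = algebraMap k B c)
    (hgen : Algebra.adjoin k (𝒜 1 : Set B) = ⊤)
    (z : B) (hz1 : z ∈ 𝒜 1) (hreg : IsRegular z) (hnorm : IsNormalElem z)
    (d : ℕ) (hd : HasGlobalDim B d) :
    HasGlobalDim (RingQuot (fun a b : B => a = z ∧ b = 0)) (d - 1) := by
  have h := isRegularNormalQuotient_ringQuot (k := k) hreg hnorm
  rcases subsingleton_or_nontrivial B with hB | hB
  · have := h.surjective.subsingleton
    have hd0 : d = 0 := Nat.le_zero.1 (hd.2 (globalDimLE_zero_of_subsingleton B))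
    subst hd0
    exact ⟨globalDimLE_zero_of_subsingleton _, fun _ _ => Nat.zero_le _⟩
  · obtain ⟨ε, hπ⟩ := GradedAlgebra.exists_isConnectedGrading 𝒜 hconn
    have hz : GradedAlgebra.proj 𝒜 1 z = z := (GradedAlgebra.proj_eq_self_iff 𝒜).2 hz1
    obtain ⟨π', ε', hπ', hε⟩ := hπ.exists_quotient hz h
    have := ε'.toRingHom.domain_nontrivial
    obtain ⟨n, rfl⟩ : ∃ n, d = n + 1 := Nat.exists_eq_succ_of_ne_zero fun hd0 =>
      h.not_globalDimLE_zero (hd0 ▸ hd.1)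
    exact ⟨h.globalDimLE hπ hz hπ' hε hd.1,
      fun m hm => Nat.le_of_succ_le_succ (hd.2 (h.globalDimLE_succ hπ hε hm))⟩
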